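/- arXiv:2111.14337 — 4 statements merged into one kernel-verified Lean document; each statement's English description precedes it below -/
import Mathlib

section
/- Let A be a real n×n matrix, let M ≥ 0 and C ≥ 0 be constants, and let (t_k)_{k∈ℕ} be a strictly increasing sequence of times with t₀ = 0 and t_k → ∞. Let y : [0, ∞) → ℝⁿ be continuous, differentiable on each interval [t_k, t_{k+1}) with y′(t) = A·y(t) there, and suppose ‖y(t_k)‖ ≤ M for every k and ∫_{0}^{∞} ‖y(s)‖² ds ≤ C. Then ‖y(t)‖² ≤ M² + 2‖A‖·C for every t ≥ 0. -/
/-- A point above the first term of a real sequence tending to infinity lies between two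
consecutive terms. -/
theorem exists_mem_Ico_of_tendsto_atTop {t : ℕ → ℝ} (ht : Filter.Tendsto t Filter.atTop Filter.atTop)
    {s : ℝ} (hs : t 0 ≤ s) : ∃ k, s ∈ Set.Ico (t k) (t (k + 1)) := by
  by_contra! h
  have hle : ∀ k, t k ≤ s := fun k => by
    induction k with
    | zero => exact hs
    | succ k ih => exact not_lt.mp fun hlt => h k ⟨ih, hlt⟩
  obtain ⟨k, hk⟩ := (ht.eventually_gt_atTop s).exists
  exact (hle k).not_gt hk

/-- Energy estimate for a solution of the linear equation `y′ = A y`. -/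
theorem norm_sq_sub_norm_sq_le_integral {E : Type*} [NormedAddCommGroup E]
    [InnerProductSpace ℝ E] (A : E →L[ℝ] E) {y : ℝ → E} {a b : ℝ} (hab : a ≤ b)
    (hcont : ContinuousOn y (Set.Icc a b))
    (hderiv : ∀ r ∈ Set.Ioo a b, HasDerivAt y (A (y r)) r) :
    ‖y b‖ ^ 2 - ‖y a‖ ^ 2 ≤ 2 * ‖A‖ * ∫ r in a..b, ‖y r‖ ^ 2 := by
  have hsq : ContinuousOn (fun r => ‖y r‖ ^ 2) (Set.Icc a b) := hcont.norm.pow 2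
  rw [← intervalIntegral.integral_const_mul]
  refine intervalIntegral.sub_le_integral_of_hasDeriv_right_of_le hab hsq
    (fun r hr => (hderiv r hr).norm_sq.hasDerivWithinAt)
    (continuousOn_const.mul hsq).integrableOn_Icc fun r _ => ?_
  calc 2 * inner ℝ (y r) (A (y r)) ≤ 2 * (‖y r‖ * (‖A‖ * ‖y r‖)) := by
        gcongr
        exact (real_inner_le_norm _ _).trans (by gcongr; exact A.le_opNorm _)
    _ = 2 * ‖A‖ * ‖y r‖ ^ 2 := by ring


/-- **Lemma 4 of the paper (core estimate).** Let `y : [0,∞) → ℝⁿ` be continuous, solving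
`y′ = A y` on each inter-event interval `[t_k, t_{k+1})`, with `‖y(t_k)‖ ≤ M` at every
event time and `∫₀^∞ ‖y‖² ≤ C` (expressed by `∫₀^T ‖y‖² ≤ C` for every `T`, which is
equivalent since the integrand is nonnegative). Then `‖y(t)‖² ≤ M² + 2‖A‖C` for all
`t ≥ 0`. Here `‖A‖` is the operator norm of the matrix `A`. -/
theorem stmt2 (n : ℕ)
    (A : EuclideanSpace ℝ (Fin n) →L[ℝ] EuclideanSpace ℝ (Fin n))
    (M C : ℝ) (hM : 0 ≤ M) (hC : 0 ≤ C)
    (t : ℕ → ℝ) (ht0 : t 0 = 0) (htmono : StrictMono t)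
    (htlim : Filter.Tendsto t Filter.atTop Filter.atTop)
    (y : ℝ → EuclideanSpace ℝ (Fin n))
    (hycont : ContinuousOn y (Set.Ici (0 : ℝ)))
    (hyderiv : ∀ k : ℕ, ∀ s ∈ Set.Ico (t k) (t (k + 1)),
      HasDerivWithinAt y (A (y s)) (Set.Ico (t k) (t (k + 1))) s)
    (hybound : ∀ k : ℕ, ‖y (t k)‖ ≤ M)
    (hyint : ∀ T : ℝ, (∫ s in (0 : ℝ)..T, ‖y s‖ ^ 2) ≤ C) :
    ∀ s ≥ (0 : ℝ), ‖y s‖ ^ 2 ≤ M ^ 2 + 2 * ‖A‖ * C := by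
  intro s hs
  obtain ⟨k, hks, hsk⟩ := exists_mem_Ico_of_tendsto_atTop htlim (ht0.trans_le hs)
  have htk : 0 ≤ t k := ht0 ▸ htmono.monotone (Nat.zero_le k)
  have hcont : ContinuousOn (fun r => ‖y r‖ ^ 2) (Set.Icc 0 s) :=
    (hycont.mono Set.Icc_subset_Ici_self).norm.pow 2
  have hgrowth : ‖y s‖ ^ 2 - ‖y (t k)‖ ^ 2 ≤ 2 * ‖A‖ * ∫ r in (t k)..s, ‖y r‖ ^ 2 := by
    refine norm_sq_sub_norm_sq_le_integral A hks
      (hycont.mono fun r hr => htk.trans hr.1) fun r hr => ?_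
    have hr' : r ∈ Set.Ico (t k) (t (k + 1)) := ⟨hr.1.le, hr.2.trans hsk⟩
    exact (hyderiv k r hr').hasDerivAt (Ico_mem_nhds hr.1 hr'.2)
  have hint : (∫ r in (t k)..s, ‖y r‖ ^ 2) ≤ C :=
    (intervalIntegral.integral_mono_interval htk hks le_rfl
      (Filter.Eventually.of_forall fun r => sq_nonneg ‖y r‖)
      (hcont.intervalIntegrable_of_Icc hs)).trans (hyint s)
  have hstart : ‖y (t k)‖ ^ 2 ≤ M ^ 2 := by gcongr; exact hybound k
  have hscaled : 2 * ‖A‖ * (∫ r in (t k)..s, ‖y r‖ ^ 2) ≤ 2 * ‖A‖ * C := by gcongr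
  linarith
end

section
/- Let A be a real n×n matrix, B a real n×m matrix, v : ℝ → ℝᵐ continuous, and let e : [t₀, ∞) → ℝⁿ be differentiable with e(t₀) = 0 and e′(t) = A·e(t) + B·v(t) for all t ≥ t₀. Then for every t ≥ t₀, ‖e(t)‖² ≤ e^{(2‖A‖ + ‖B‖²)(t − t₀)} · ∫_{t₀}^{t} ‖v(s)‖² ds. -/
/-- Young-type bound on the derivative of `‖x‖ ^ 2` along `x' = A x + B u`. -/
theorem two_mul_inner_add_le {E F : Type*} [NormedAddCommGroup E] [InnerProductSpace ℝ E]
    [NormedAddCommGroup F] [NormedSpace ℝ F] (A : E →L[ℝ] E) (B : F →L[ℝ] E) (x : E) (u : F) :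
    2 * inner ℝ x (A x + B u) ≤ (2 * ‖A‖ + ‖B‖ ^ 2) * ‖x‖ ^ 2 + ‖u‖ ^ 2 := by
  have hA : inner ℝ x (A x) ≤ ‖x‖ * (‖A‖ * ‖x‖) :=
    (real_inner_le_norm _ _).trans (by gcongr; exact A.le_opNorm x)
  have hB : inner ℝ x (B u) ≤ ‖x‖ * (‖B‖ * ‖u‖) :=
    (real_inner_le_norm _ _).trans (by gcongr; exact B.le_opNorm u)
  rw [inner_add_right]
  nlinarith [sq_nonneg (‖B‖ * ‖x‖ - ‖u‖)]

/-- Grönwall's inequality in differential form with a continuous nonnegative forcing term. -/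
theorem le_exp_mul_integral_of_hasDerivAt {f f' g : ℝ → ℝ} {c a : ℝ} (hc : 0 ≤ c)
    (hg : Continuous g) (hg0 : ∀ t, 0 ≤ g t) (ha : f a = 0)
    (hf : ∀ t ≥ a, HasDerivAt f (f' t) t) (hf' : ∀ t ≥ a, f' t ≤ c * f t + g t)
    {t : ℝ} (ht : a ≤ t) :
    f t ≤ Real.exp (c * (t - a)) * ∫ s in a..t, g s := by
  have hexp (s : ℝ) : HasDerivAt (fun s => Real.exp (-(c * (s - a))))
      (Real.exp (-(c * (s - a))) * -c) s := by
    simpa using (((hasDerivAt_id s).sub_const a).const_mul c).neg.exp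
  have hint (s : ℝ) : HasDerivAt (fun s => ∫ r in a..s, g r) (g s) s :=
    hg.integral_hasStrictDerivAt a s |>.hasDerivAt
  have key : Real.exp (-(c * (t - a))) * f t ≤ ∫ s in a..t, g s := by
    refine image_le_of_deriv_right_le_deriv_boundary (a := a) (b := t)
      (f := fun s => Real.exp (-(c * (s - a))) * f s) (B := fun s => ∫ r in a..s, g r)
      (fun s hs => ((hexp s).mul (hf s hs.1)).continuousAt.continuousWithinAt)
      (fun s hs => ((hexp s).mul (hf s hs.1)).hasDerivWithinAt) (by simp [ha])
      (fun s _ => (hint s).continuousAt.continuousWithinAt)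
      (fun s _ => (hint s).hasDerivWithinAt) (fun s hs => ?_) (Set.right_mem_Icc.2 ht)
    have hle : Real.exp (-(c * (s - a))) ≤ 1 :=
      Real.exp_le_one_iff.2 (neg_nonpos.2 (mul_nonneg hc (sub_nonneg.2 hs.1)))
    calc Real.exp (-(c * (s - a))) * -c * f s + Real.exp (-(c * (s - a))) * f' s
        = Real.exp (-(c * (s - a))) * (f' s - c * f s) := by ring
      _ ≤ Real.exp (-(c * (s - a))) * g s := by
        gcongr
        linarith [hf' s hs.1]
      _ ≤ g s := mul_le_of_le_one_left (hg0 s) hle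
  calc f t = Real.exp (c * (t - a)) * (Real.exp (-(c * (t - a))) * f t) := by
        rw [← mul_assoc, ← Real.exp_add, add_neg_cancel, Real.exp_zero, one_mul]
    _ ≤ _ := by gcongr

/-- **Pointwise error-growth estimate.** If `e` solves `e′ = A e + B v` on `[t₀, ∞)` with
`e(t₀) = 0`, where `A : ℝⁿ → ℝⁿ` and `B : ℝᵐ → ℝⁿ` are linear operators (matrices, with
`‖·‖` the operator norm) and `v` is continuous, then for every `t ≥ t₀`,
`‖e(t)‖² ≤ exp((2‖A‖ + ‖B‖²)(t − t₀)) ∫_{t₀}^{t} ‖v(s)‖² ds`. -/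
theorem stmt4 (n m : ℕ)
    (A : EuclideanSpace ℝ (Fin n) →L[ℝ] EuclideanSpace ℝ (Fin n))
    (B : EuclideanSpace ℝ (Fin m) →L[ℝ] EuclideanSpace ℝ (Fin n))
    (v : ℝ → EuclideanSpace ℝ (Fin m)) (hv : Continuous v)
    (t₀ : ℝ) (e : ℝ → EuclideanSpace ℝ (Fin n))
    (he0 : e t₀ = 0)
    (hederiv : ∀ t ≥ t₀, HasDerivAt e (A (e t) + B (v t)) t) :
    ∀ t ≥ t₀, ‖e t‖ ^ 2 ≤
      Real.exp ((2 * ‖A‖ + ‖B‖ ^ 2) * (t - t₀)) * ∫ s in t₀..t, ‖v s‖ ^ 2 := by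
  intro t ht
  exact le_exp_mul_integral_of_hasDerivAt (f := fun s => ‖e s‖ ^ 2) (by positivity)
    (hv.norm.pow 2) (fun s => sq_nonneg _) (by simp [he0]) (fun s hs => (hederiv s hs).norm_sq)
    (fun s _ => two_mul_inner_add_le A B (e s) (v s)) ht
end

section
/- Let A be a real n×n matrix, B a real n×m matrix, v : ℝ → ℝᵐ continuous, and let e : [t₀, ∞) → ℝⁿ be differentiable with e(t₀) = 0 and e′(t) = A·e(t) + B·v(t) for all t ≥ t₀. Set c = 2‖A‖ + ‖B‖². Then for every t ≥ t₀, ∫_{t₀}^{t} ‖e(s)‖² ds ≤ (∫_{t₀}^{t} e^{c(s − t₀)} ds) · ∫_{t₀}^{t} ‖v(s)‖² ds. -/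
open intervalIntegral in
/-- Grönwall-type bound: if the derivative of `f` is at most `c f + g` on `[t₀, ∞)` with `f t₀ = 0`, `c ≥ 0` and `g ≥ 0`
continuous, then `f t ≤ e^{c(t - t₀)} ∫_{t₀}^{t} g`. -/
theorem le_exp_mul_integral_of_hasDerivAt_le {f f' g : ℝ → ℝ} {c t₀ : ℝ} (hc : 0 ≤ c)
    (hg : Continuous g) (hg0 : ∀ t, 0 ≤ g t) (hf0 : f t₀ = 0)
    (hf : ∀ t ≥ t₀, HasDerivAt f (f' t) t) (hle : ∀ t ≥ t₀, f' t ≤ c * f t + g t)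
    {t : ℝ} (ht : t₀ ≤ t) :
    f t ≤ Real.exp (c * (t - t₀)) * ∫ s in t₀..t, g s := by
  have hderiv : ∀ s ≥ t₀, HasDerivAt
      (fun s => Real.exp (-(c * (s - t₀))) * f s - ∫ r in t₀..s, g r)
      (Real.exp (-(c * (s - t₀))) * (f' s - c * f s) - g s) s := by
    intro s hs
    have hexp : HasDerivAt (fun s => Real.exp (-(c * (s - t₀))))
        (Real.exp (-(c * (s - t₀))) * -(c * 1)) s :=
      (((hasDerivAt_id s).sub_const t₀).const_mul c).neg.exp
    exact ((hexp.mul (hf s hs)).sub (hg.integral_hasStrictDerivAt t₀ s).hasDerivAt).congr_deriv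
      (by ring)
  have hanti : AntitoneOn
      (fun s => Real.exp (-(c * (s - t₀))) * f s - ∫ r in t₀..s, g r) (Set.Ici t₀) := by
    refine antitoneOn_of_hasDerivWithinAt_nonpos (convex_Ici t₀)
      (fun s hs => (hderiv s hs).continuousAt.continuousWithinAt)
      (fun s hs => (hderiv s (interior_subset hs)).hasDerivWithinAt) (fun s hs => ?_)
    have hs : t₀ ≤ s := interior_subset hs
    have hexp_le : Real.exp (-(c * (s - t₀))) ≤ 1 :=
      Real.exp_le_one_iff.2 (neg_nonpos.2 (mul_nonneg hc (sub_nonneg.2 hs)))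
    have h₁ : Real.exp (-(c * (s - t₀))) * (f' s - c * f s) ≤
        Real.exp (-(c * (s - t₀))) * g s :=
      mul_le_mul_of_nonneg_left (by linarith [hle s hs]) (Real.exp_pos _).le
    linarith [mul_le_mul_of_nonneg_right hexp_le (hg0 s)]
  have h := hanti Set.self_mem_Ici ht ht
  simp only [hf0, mul_zero, integral_same, sub_zero, sub_nonpos] at h
  rwa [Real.exp_neg, inv_mul_le_iff₀ (Real.exp_pos _)] at h

/-- **Integrated error-growth estimate.** If `e` solves `e′ = A e + B v` on `[t₀, ∞)` with
`e(t₀) = 0`, where `A : ℝⁿ → ℝⁿ` and `B : ℝᵐ → ℝⁿ` are linear operators (matrices, with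
`‖·‖` the operator norm), `v` continuous, and `c = 2‖A‖ + ‖B‖²`, then for every `t ≥ t₀`,
`∫_{t₀}^{t} ‖e(s)‖² ds ≤ (∫_{t₀}^{t} e^{c(s−t₀)} ds) · ∫_{t₀}^{t} ‖v(s)‖² ds`. -/
theorem stmt5 (n m : ℕ)
    (A : EuclideanSpace ℝ (Fin n) →L[ℝ] EuclideanSpace ℝ (Fin n))
    (B : EuclideanSpace ℝ (Fin m) →L[ℝ] EuclideanSpace ℝ (Fin n))
    (v : ℝ → EuclideanSpace ℝ (Fin m)) (hv : Continuous v)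
    (t₀ : ℝ) (e : ℝ → EuclideanSpace ℝ (Fin n))
    (he0 : e t₀ = 0)
    (hederiv : ∀ t ≥ t₀, HasDerivAt e (A (e t) + B (v t)) t)
    (c : ℝ) (hc : c = 2 * ‖A‖ + ‖B‖ ^ 2) :
    ∀ t ≥ t₀, (∫ s in t₀..t, ‖e s‖ ^ 2) ≤
      (∫ s in t₀..t, Real.exp (c * (s - t₀))) * ∫ s in t₀..t, ‖v s‖ ^ 2 := by
  intro t ht
  have hc0 : 0 ≤ c := by rw [hc]; positivity
  have hv2 : Continuous fun s => ‖v s‖ ^ 2 := hv.norm.pow 2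
  have hpt : ∀ s ∈ Set.Icc t₀ t,
      ‖e s‖ ^ 2 ≤ Real.exp (c * (s - t₀)) * ∫ r in t₀..t, ‖v r‖ ^ 2 := by
    intro s hs
    refine (le_exp_mul_integral_of_hasDerivAt_le (f := fun s => ‖e s‖ ^ 2) hc0 hv2
      (fun _ => sq_nonneg _) (by simp [he0]) (fun r hr => (hederiv r hr).norm_sq)
      (fun r _ => hc ▸ two_mul_inner_add_le A B (e r) (v r)) hs.1).trans ?_
    gcongr
    exact intervalIntegral.integral_mono_interval le_rfl hs.1 hs.2
      (Filter.Eventually.of_forall fun _ => sq_nonneg _) (hv2.intervalIntegrable _ _)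
  have he2 : ContinuousOn (fun s => ‖e s‖ ^ 2) (Set.uIcc t₀ t) := by
    rw [Set.uIcc_of_le ht]
    exact fun s hs => ((hederiv s hs.1).continuousAt.norm.pow 2).continuousWithinAt
  rw [← intervalIntegral.integral_mul_const]
  exact intervalIntegral.integral_mono_on ht he2.intervalIntegrable
    (Continuous.intervalIntegrable (by fun_prop) _ _) hpt
end

section
/- Let L be a real symmetric N×N matrix, ξ ∈ ℝ^N, and α ≥ 0 such that yᵀL y ≥ α‖y‖² for every y ∈ ℝ^N with ⟨y, ξ⟩ = 0. Let M be a real symmetric positive semidefinite n×n matrix. Then for every δ ∈ ℝ^{Nn}, written in blocks δ = (δ₁, …, δ_N) with δ_k ∈ ℝⁿ, satisfying Σ_{k=1}^{N} ξ_k δ_k = 0 ∈ ℝⁿ, one has δᵀ (L ⊗ M) δ ≥ α · δᵀ (I_N ⊗ M) δ, where ⊗ denotes the Kronecker product. -/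
open Matrix Kronecker

/-- The quadratic form of `A ⊗ M` for a sum of rank-one matrices `M = ∑ i, vᵢ vᵢᵀ` is a sum of
quadratic forms of `A`. -/
theorem dotProduct_kronecker_sum_vecMulVec_mulVec {R ι κ η : Type*} [CommSemiring R] [Fintype ι]
    [Fintype κ] [Fintype η] (A : Matrix κ κ R) (v : ι → η → R) (δ : κ × η → R) :
    δ ⬝ᵥ (A ⊗ₖ ∑ i, vecMulVec (v i) (v i)).mulVec δ =
      ∑ i, (fun k ↦ ∑ j, v i j * δ (k, j)) ⬝ᵥ A.mulVec (fun k ↦ ∑ j, v i j * δ (k, j)) := by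
  simp only [dotProduct, mulVec, kroneckerMap_apply, Matrix.sum_apply, vecMulVec_apply,
    Fintype.sum_prod_type, Finset.mul_sum, Finset.sum_mul]
  simp_rw [Finset.sum_comm (s := (Finset.univ : Finset ι))]
  refine Finset.sum_congr rfl fun k _ ↦ ?_
  rw [Finset.sum_comm]
  refine Finset.sum_congr rfl fun l _ ↦ ?_
  rw [Finset.sum_comm]
  refine Finset.sum_congr rfl fun p _ ↦ Finset.sum_congr rfl fun q _ ↦
    Finset.sum_congr rfl fun i _ ↦ ?_
  ring

/-- **Algebraic-connectivity bound for Kronecker products.** Let `L` be a real symmetric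
`N × N` matrix, `ξ ∈ ℝᴺ`, and `α ≥ 0` with `yᵀ L y ≥ α ‖y‖²` for all `y ⊥ ξ`. Let `M` be
real symmetric positive semidefinite `n × n`. Then every block vector
`δ = (δ₁, …, δ_N) ∈ ℝ^{Nn}` with `Σ_k ξ_k δ_k = 0` satisfies
`δᵀ (L ⊗ M) δ ≥ α · δᵀ (I_N ⊗ M) δ`. -/
theorem stmt7 (N n : ℕ)
    (L : Matrix (Fin N) (Fin N) ℝ) (hL : L.IsSymm)
    (ξ : Fin N → ℝ) (α : ℝ) (hα : 0 ≤ α)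
    (hLα : ∀ y : Fin N → ℝ, (∑ k, y k * ξ k) = 0 →
      α * (∑ k, (y k) ^ 2) ≤ y ⬝ᵥ L.mulVec y)
    (M : Matrix (Fin n) (Fin n) ℝ) (hM : M.PosSemidef)
    (δ : Fin N × Fin n → ℝ)
    (hδ : ∀ j : Fin n, (∑ k, ξ k * δ (k, j)) = 0) :
    α * (δ ⬝ᵥ ((1 : Matrix (Fin N) (Fin N) ℝ) ⊗ₖ M).mulVec δ) ≤
      δ ⬝ᵥ (L ⊗ₖ M).mulVec δ := by
  obtain ⟨m, v, rfl⟩ := posSemidef_iff_eq_sum_vecMulVec.mp hM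
  simp only [star_trivial, dotProduct_kronecker_sum_vecMulVec_mulVec]
  rw [Finset.mul_sum]
  refine Finset.sum_le_sum fun i _ ↦ ?_
  refine le_of_eq_of_le ?_ (hLα (fun k ↦ ∑ j, v i j * δ (k, j)) ?_)
  · simp [dotProduct, sq]
  · simp_rw [Finset.sum_mul]
    rw [Finset.sum_comm]
    refine Finset.sum_eq_zero fun j _ ↦ ?_
    rw [← mul_zero (v i j), ← hδ j, Finset.mul_sum]
    exact Finset.sum_congr rfl fun k _ ↦ by ring
end
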